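/- Let q be an odd prime power and F(X) ∈ F_q[X] a monic irreducible polynomial of degree n ≥ 1 with (-1)^n F(0) a non-square in F_q. For k ≥ 2, the polynomial F(X^{2^k}) is irreducible over F_q if and only if either q ≡ 1 (mod 4), or q ≡ 3 (mod 4) and n is even. -/

import Mathlib

open Polynomial

theorem Polynomial.coeff_zero_comp_X_pow {R : Type*} [CommSemiring R] (p : R[X]) {m : ℕ}
    (hm : m ≠ 0) : (p.comp (X ^ m)).coeff 0 = p.coeff 0 := by
  simp [coeff_zero_eq_eval_zero, hm]

theorem Irreducible.comp_X_sq {K : Type*} [Field K] {P : K[X]} (hirr : Irreducible P)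
    (hm : P.Monic) (hns : ¬ IsSquare ((-1 : K) ^ P.natDegree * P.coeff 0)) :
    Irreducible (P.comp (X ^ 2)) := by
  refine irreducible_comp hm (monic_X_pow 2) hirr fun E _ _ x hx ↦ ?_
  have hint : IsIntegral K x := not_not.mp fun h ↦ hirr.ne_zero (hx.symm.trans (dif_neg h))
  rw [Polynomial.map_pow, map_X]
  refine X_pow_sub_C_irreducible_of_prime Nat.prime_two fun b hb ↦ hns ⟨Algebra.norm K b, ?_⟩
  rw [← map_mul, ← sq, hb, ← IntermediateField.adjoin.powerBasis_gen hint,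
    Algebra.PowerBasis.norm_gen_eq_coeff_zero_minpoly]
  simp [IntermediateField.minpoly_gen, hx]

theorem Irreducible.comp_X_pow_two_pow {K : Type*} [Field K] {P : K[X]} (hirr : Irreducible P)
    (hm : P.Monic) (hs : IsSquare ((-1 : K) ^ P.natDegree)) (hns : ¬ IsSquare (P.coeff 0))
    (k : ℕ) : Irreducible (P.comp (X ^ 2 ^ k)) := by
  induction k generalizing P with
  | zero => simpa using hirr
  | succ k ih =>
    have hns' : ¬ IsSquare ((-1 : K) ^ P.natDegree * P.coeff 0) := fun h ↦ hns <| by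
      simpa [← mul_assoc, ← mul_pow] using hs.mul h
    have := ih (hirr.comp_X_sq hm hns') (hm.comp (monic_X_pow 2) (by simp))
      (by simp [natDegree_comp, pow_mul']) (by rwa [coeff_zero_comp_X_pow P two_ne_zero])
    rwa [comp_assoc, pow_comp, X_comp, ← pow_mul, ← pow_succ] at this

/-- With `q = |F|`, a root `γ` of `P(X⁴)` satisfies `γ ^ (4 * (q ^ n - 1)) = 1`, hence lies in the
extension of degree `2 * n`, because `4 ∣ q ^ n + 1`. -/
theorem Irreducible.not_irreducible_comp_X_pow_four {F : Type*} [Field F] [Fintype F] {P : F[X]}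
    (hirr : Irreducible P) (h0 : P.coeff 0 ≠ 0)
    (h4 : 4 ∣ Fintype.card F ^ P.natDegree + 1) : ¬ Irreducible (P.comp (X ^ 4)) := by
  intro h
  have hpos := hirr.natDegree_pos
  obtain ⟨m, hm⟩ := h4
  set Q := Fintype.card F ^ P.natDegree with hQ
  have hQpos : 1 ≤ Q := Nat.one_le_pow _ _ Fintype.card_pos
  have hX : P ∣ X * (X ^ (Q - 1) - 1) := by
    have := hirr.natDegree_dvd_iff_dvd_X_pow_card_pow_sub_X.mp dvd_rfl
    rw [Nat.card_eq_fintype_card, ← hQ] at this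
    rwa [mul_sub, ← pow_succ', Nat.sub_add_cancel hQpos, mul_one]
  have hP : P ∣ X ^ (Q - 1) - 1 := by
    refine (hirr.prime.dvd_or_dvd hX).resolve_left fun hdvd ↦ h0 ?_
    have hass := hirr.associated_of_dvd irreducible_X hdvd
    exact X_dvd_iff.mp hass.symm.dvd
  have hcomp : P.comp (X ^ 4) ∣ X ^ (4 * (Q - 1)) - 1 := by
    obtain ⟨R, hR⟩ := hP
    exact ⟨R.comp (X ^ 4), by rw [← mul_comp, ← hR]; simp [pow_mul]⟩
  have hexp : 4 * (Q - 1) * m + 1 = Q ^ 2 := by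
    obtain ⟨r, hr⟩ := Nat.exists_eq_add_of_le hQpos
    rw [hr] at hm ⊢
    rw [Nat.add_sub_cancel_left]
    linear_combination r * hm.symm
  have hdvd : P.comp (X ^ 4) ∣ X ^ Nat.card F ^ (P.natDegree * 2) - X := by
    rw [Nat.card_eq_fintype_card, pow_mul, ← hQ, ← hexp, pow_succ _ (4 * (Q - 1) * m),
      ← sub_one_mul, pow_mul _ (4 * (Q - 1)) m]
    refine (hcomp.trans ?_).mul_right _
    simpa using sub_dvd_pow_sub_pow (X ^ (4 * (Q - 1)) : F[X]) 1 m
  have hle := Nat.le_of_dvd (by omega) (h.natDegree_dvd_of_dvd_X_pow_card_pow_sub_X hdvd)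
  rw [natDegree_comp, natDegree_X_pow] at hle
  omega

theorem stmt_7 (F : Type*) [Field F] [Fintype F] (hq : Odd (Fintype.card F))
    (n : ℕ) (hn : 1 ≤ n) (P : F[X]) (hm : P.Monic) (hirr : Irreducible P)
    (hdeg : P.natDegree = n) (hns : ¬ IsSquare ((-1 : F) ^ n * P.coeff 0))
    (k : ℕ) (hk : 2 ≤ k) :
    Irreducible (P.comp (X ^ 2 ^ k)) ↔
      (Fintype.card F % 4 = 1 ∨ (Fintype.card F % 4 = 3 ∧ Even n)) := by
  subst hdeg
  constructor
  · intro h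
    by_contra! hcon
    have h3 : Fintype.card F % 4 = 3 := by
      have := hq
      rw [Nat.odd_iff] at this
      omega
    have hodd : Odd P.natDegree := Nat.not_even_iff_odd.mp (hcon.2 h3)
    refine hirr.not_irreducible_comp_X_pow_four (fun h0 ↦ hns (by simp [h0])) ?_ ?_
    · have h4 : 4 ∣ Fintype.card F + 1 := by omega
      simpa using h4.trans (hodd.nat_add_dvd_pow_add_pow (Fintype.card F) 1)
    · obtain ⟨j, rfl⟩ := Nat.exists_eq_add_of_le' hk
      refine of_irreducible_expand_pow (p := 2) (n := j) two_ne_zero ?_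
      rwa [expand_eq_comp_X_pow, comp_assoc, pow_comp, X_comp, ← pow_mul,
        show 2 ^ j * 4 = 2 ^ (j + 2) by ring]
  · intro h
    have hs : IsSquare ((-1 : F) ^ P.natDegree) := by
      rcases h with h | ⟨-, h⟩
      · exact (FiniteField.isSquare_neg_one_iff.mpr (by omega)).pow _
      · exact h.isSquare_pow _
    exact hirr.comp_X_pow_two_pow hm hs (fun h0 ↦ hns (hs.mul h0)) k
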